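/- Assume (H_c). If the equation u_t = (a(u,u_x))_x + f(u) admits a classic traveling wave moving at speed σ_r, then σ_s = σ_r. -/

import Mathlib

open Set Filter Topology
open scoped ENNReal

noncomputable section

/-- The strip `Ω` between `-ω` and `ω` over `[0,1]`:
`Ω = {(u,s) : u ∈ [0,1], -ω(u) < s < ω(u)}`. -/
def OmegaSet (ω : ℝ → ℝ≥0∞) : Set (ℝ × ℝ) :=
  {p | p.1 ∈ Set.Icc (0:ℝ) 1 ∧ ENNReal.ofReal |p.2| < ω p.1}

/-- The set `𝒟` between `a₋ = -a₊` and `a₊` over `[0,1]`. -/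
def DSet (aplus : ℝ → ℝ≥0∞) : Set (ℝ × ℝ) :=
  {p | p.1 ∈ Set.Icc (0:ℝ) 1 ∧ ENNReal.ofReal |p.2| < aplus p.1}

/-- Standing data and hypotheses: a lower semicontinuous width `ω : [0,1] → (0,∞]`,
a regular flux `a` on `Ω` (odd in `s`, C¹, with `∂a/∂s > 0`), the maximal fluxes
`a₊(u) = lim_{s→ω(u)⁻} a(u,s)` (equivalently, the supremum over `0 < s < ω(u)`),
which are `+∞` whenever `ω(u) < ∞`, the partial inverse `g` on `𝒟` defined by
`a(u, g(u,v)) = v`, and a logistic-type reaction term `f`. -/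
structure FluxData where
  ω : ℝ → ℝ≥0∞
  a : ℝ → ℝ → ℝ
  aplus : ℝ → ℝ≥0∞
  g : ℝ → ℝ → ℝ
  f : ℝ → ℝ
  ω_pos : ∀ u ∈ Set.Icc (0:ℝ) 1, 0 < ω u
  ω_lsc : LowerSemicontinuousOn ω (Set.Icc (0:ℝ) 1)
  a_odd : ∀ u s, (u, s) ∈ OmegaSet ω → a u (-s) = - a u s
  a_C1 : ContDiffOn ℝ 1 (fun p : ℝ × ℝ => a p.1 p.2) (OmegaSet ω)
  a_deriv_pos : ∀ u s, (u, s) ∈ OmegaSet ω → ∃ d : ℝ, 0 < d ∧ HasDerivAt (a u) d s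
  aplus_def : ∀ u ∈ Set.Icc (0:ℝ) 1,
      aplus u = ⨆ s ∈ {s : ℝ | 0 < s ∧ (u, s) ∈ OmegaSet ω}, ENNReal.ofReal (a u s)
  aplus_pos : ∀ u ∈ Set.Icc (0:ℝ) 1, 0 < aplus u
  aplus_top : ∀ u ∈ Set.Icc (0:ℝ) 1, ω u < ⊤ → aplus u = ⊤
  g_spec : ∀ p ∈ DSet aplus, (p.1, g p.1 p.2) ∈ OmegaSet ω ∧ a p.1 (g p.1 p.2) = p.2
  f_C1 : ContDiffOn ℝ 1 f (Set.Icc (0:ℝ) 1)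
  f_zero : f 0 = 0
  f_one : f 1 = 0
  f_pos : ∀ u ∈ Set.Ioo (0:ℝ) 1, 0 < f u

/-- A classic traveling wave of `u_t = (b(u,u_x))_x + f(u)` moving at speed `σ`:
a C² increasing profile `u` with values in `(0,1)`, `0 < u' < ω(u)`, connecting
`0` at `-∞` to `1` at `+∞`, such that `ξ ↦ b(u(ξ),u'(ξ))` is differentiable and
`(b(u,u'))' - σ u' + f(u) = 0`. -/
def IsClassicTW (F : FluxData) (b : ℝ → ℝ → ℝ) (σ : ℝ) (u : ℝ → ℝ) : Prop :=
  ContDiff ℝ 2 u ∧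
  (∀ ξ : ℝ, u ξ ∈ Set.Ioo (0:ℝ) 1) ∧
  (∀ ξ : ℝ, 0 < deriv u ξ ∧ ENNReal.ofReal (deriv u ξ) < F.ω (u ξ)) ∧
  Filter.Tendsto u Filter.atBot (nhds 0) ∧
  Filter.Tendsto u Filter.atTop (nhds 1) ∧
  (∀ ξ : ℝ, HasDerivAt (fun t => b (u t) (deriv u t)) (σ * deriv u ξ - F.f (u ξ)) ξ)

/-- A right solution with speed `σ`: `V : (α,1] → ℝ`, continuous on `(α,1]`,
C¹ on `(α,1)`, `V(1) = 0`, and on `(α,1)` : `V > 0`, `(u,V(u)) ∈ 𝒟` and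
`V' = σ - f(u)/g(u,V(u))`. -/
def IsRightSolution (F : FluxData) (σ α : ℝ) (V : ℝ → ℝ) : Prop :=
  α ∈ Set.Ico (0:ℝ) 1 ∧
  ContinuousOn V (Set.Ioc α 1) ∧
  V 1 = 0 ∧
  ∀ u ∈ Set.Ioo α 1, 0 < V u ∧ (u, V u) ∈ DSet F.aplus ∧
    HasDerivAt V (σ - F.f u / F.g u (V u)) u

open Classical in
/-- `ℋ(u,V) = 1/g(u,V)` if `0 < V < a₊(u)`, and `0` if `V ≥ a₊(u)`. -/
def Hfun (F : FluxData) (u V : ℝ) : ℝ :=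
  if ENNReal.ofReal V < F.aplus u then 1 / F.g u V else 0

/-- The solution `𝒱_σ` of the extended problem: continuous on `[0,1]`, C¹ on `(0,1)`,
`𝒱(1) = 0`, `𝒱 > 0` on `(0,1)` and `𝒱' = σ - f(u)·ℋ(u,𝒱(u))` on `(0,1)`. -/
def IsVsol (F : FluxData) (σ : ℝ) (V : ℝ → ℝ) : Prop :=
  ContinuousOn V (Set.Icc (0:ℝ) 1) ∧ V 1 = 0 ∧
  (∀ u ∈ Set.Ioo (0:ℝ) 1, 0 < V u) ∧
  (∀ u ∈ Set.Ioo (0:ℝ) 1, HasDerivAt V (σ - F.f u * Hfun F u (V u)) u)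

namespace FluxData

variable (F : FluxData)

lemma mem_of_abs_le {u s t : ℝ} (h : (u, s) ∈ OmegaSet F.ω) (hts : |t| ≤ |s|) :
    (u, t) ∈ OmegaSet F.ω :=
  ⟨h.1, lt_of_le_of_lt (ENNReal.ofReal_le_ofReal hts) h.2⟩

lemma zero_mem {u : ℝ} (hu : u ∈ Icc (0:ℝ) 1) : (u, (0:ℝ)) ∈ OmegaSet F.ω :=
  ⟨hu, by simpa using F.ω_pos u hu⟩

lemma a_zero {u : ℝ} (hu : u ∈ Icc (0:ℝ) 1) : F.a u 0 = 0 := by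
  have := F.a_odd u 0 (F.zero_mem hu)
  rw [neg_zero] at this
  linarith

lemma a_lt {u s t : ℝ} (hs : (u, s) ∈ OmegaSet F.ω) (ht : (u, t) ∈ OmegaSet F.ω)
    (hst : s < t) : F.a u s < F.a u t := by
  have hmem : ∀ x ∈ Icc s t, (u, x) ∈ OmegaSet F.ω := by
    intro x hx
    rcases le_total |s| |t| with h | h
    · exact F.mem_of_abs_le ht ((abs_le_max_abs_abs hx.1 hx.2).trans (max_le h le_rfl))
    · exact F.mem_of_abs_le hs ((abs_le_max_abs_abs hx.1 hx.2).trans (max_le le_rfl h))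
  have hmono : StrictMonoOn (F.a u) (Icc s t) := by
    refine strictMonoOn_of_deriv_pos (convex_Icc s t) ?_ ?_
    · intro x hx
      obtain ⟨d, -, h⟩ := F.a_deriv_pos u x (hmem x hx)
      exact h.continuousAt.continuousWithinAt
    · intro x hx
      obtain ⟨d, hd, h⟩ := F.a_deriv_pos u x (hmem x (interior_subset hx))
      rwa [h.deriv]
  exact hmono (left_mem_Icc.2 hst.le) (right_mem_Icc.2 hst.le) hst

lemma a_inj {u s t : ℝ} (hs : (u, s) ∈ OmegaSet F.ω) (ht : (u, t) ∈ OmegaSet F.ω)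
    (hst : F.a u s = F.a u t) : s = t := by
  rcases lt_trichotomy s t with h | h | h
  · exact absurd hst (F.a_lt hs ht h).ne
  · exact h
  · exact absurd hst (F.a_lt ht hs h).ne'

lemma a_pos {u s : ℝ} (hs : (u, s) ∈ OmegaSet F.ω) (h : 0 < s) : 0 < F.a u s := by
  have := F.a_lt (F.zero_mem hs.1) hs h
  rwa [F.a_zero hs.1] at this

lemma ofReal_a_lt {u s : ℝ} (hs : (u, s) ∈ OmegaSet F.ω) (h : 0 < s) :
    ENNReal.ofReal (F.a u s) < F.aplus u := by
  obtain ⟨r, hr1, hr2⟩ := ENNReal.lt_iff_exists_nnreal_btwn.1 hs.2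
  have hsr : s < r := by
    have : ENNReal.ofReal |s| < ENNReal.ofReal r := by simpa using hr1
    rw [ENNReal.ofReal_lt_ofReal_iff_of_nonneg (abs_nonneg _)] at this
    exact (le_abs_self s).trans_lt this
  have hr : (u, (r:ℝ)) ∈ OmegaSet F.ω := ⟨hs.1, by simpa using hr2⟩
  have h1 := F.a_lt hs hr hsr
  have h2 : ENNReal.ofReal (F.a u r) ≤ F.aplus u := by
    rw [F.aplus_def u hs.1]
    exact le_iSup₂ (f := fun (s : ℝ) (_ : s ∈ {s : ℝ | 0 < s ∧ (u, s) ∈ OmegaSet F.ω}) =>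
      ENNReal.ofReal (F.a u s)) (r:ℝ) ⟨h.trans hsr, hr⟩
  refine lt_of_lt_of_le ?_ h2
  exact (ENNReal.ofReal_lt_ofReal_iff_of_nonneg (F.a_pos hs h).le).2 h1

lemma mem_DSet {u v : ℝ} (hu : u ∈ Icc (0:ℝ) 1) (hv : 0 ≤ v)
    (h : ENNReal.ofReal v < F.aplus u) : (u, v) ∈ DSet F.aplus :=
  ⟨hu, by simpa [abs_of_nonneg hv] using h⟩

lemma g_a {u s : ℝ} (hs : (u, s) ∈ OmegaSet F.ω) (h : 0 < s) : F.g u (F.a u s) = s := by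
  have := F.g_spec _ (F.mem_DSet hs.1 (F.a_pos hs h).le (F.ofReal_a_lt hs h))
  exact F.a_inj this.1 hs this.2

lemma g_pos {u v : ℝ} (hu : u ∈ Icc (0:ℝ) 1) (hv : 0 < v)
    (h : ENNReal.ofReal v < F.aplus u) : 0 < F.g u v := by
  obtain ⟨h1, h2⟩ := F.g_spec _ (F.mem_DSet hu hv.le h)
  by_contra! hn
  rcases hn.lt_or_eq with hn | hn
  · have := F.a_lt h1 (F.zero_mem hu) hn
    rw [F.a_zero hu, h2] at this
    exact lt_asymm this hv
  · simp only at hn h2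
    rw [hn, F.a_zero hu] at h2
    exact hv.ne h2

lemma Hfun_nonneg {u v : ℝ} (hu : u ∈ Icc (0:ℝ) 1) (hv : 0 < v) : 0 ≤ Hfun F u v := by
  unfold Hfun
  split_ifs with h
  · exact (one_div_pos.2 (F.g_pos hu hv h)).le
  · exact le_rfl

lemma Hfun_anti {u v w : ℝ} (hu : u ∈ Icc (0:ℝ) 1) (hv : 0 < v) (hvw : v ≤ w) :
    Hfun F u w ≤ Hfun F u v := by
  by_cases hw : ENNReal.ofReal w < F.aplus u
  · have hv' : ENNReal.ofReal v < F.aplus u := (ENNReal.ofReal_le_ofReal hvw).trans_lt hw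
    rw [Hfun, Hfun, if_pos hw, if_pos hv']
    refine one_div_le_one_div_of_le (F.g_pos hu hv hv') ?_
    by_contra! hn
    have h1 := F.g_spec _ (F.mem_DSet hu hv.le hv')
    have h2 := F.g_spec _ (F.mem_DSet hu (hv.le.trans hvw) hw)
    have := F.a_lt h2.1 h1.1 hn
    rw [h1.2, h2.2] at this
    exact this.not_ge hvw
  · rw [Hfun, if_neg hw]
    exact F.Hfun_nonneg hu hv

lemma Hfun_a {u s : ℝ} (hs : (u, s) ∈ OmegaSet F.ω) (h : 0 < s) :
    Hfun F u (F.a u s) = 1 / s := by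
  rw [Hfun, if_pos (F.ofReal_a_lt hs h), F.g_a hs h]

/-- Near `s = 0` the flux is comparable to `s`, uniformly in `u`. -/
lemma exists_linear_bounds : ∃ s₀ m M : ℝ, 0 < s₀ ∧ 0 < m ∧ 0 < M ∧
    ∀ u ∈ Icc (0:ℝ) 1, ∀ s ∈ Icc 0 s₀, (u, s) ∈ OmegaSet F.ω ∧
      m * s ≤ F.a u s ∧ F.a u s ≤ M * s := by
  obtain ⟨u₀, hu₀, hmin⟩ := F.ω_lsc.exists_isMinOn ⟨0, by simp⟩ isCompact_Icc
  obtain ⟨r, hr0, hr⟩ := ENNReal.lt_iff_exists_nnreal_btwn.1 (F.ω_pos u₀ hu₀)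
  have hr0 : (0:ℝ) < r := by exact_mod_cast hr0
  set K : Set (ℝ × ℝ) := Icc (0:ℝ) 1 ×ˢ Icc (0:ℝ) r with hK
  have hmem : ∀ u ∈ Icc (0:ℝ) 1, ∀ s ∈ Icc (0:ℝ) r, (u, s) ∈ OmegaSet F.ω := by
    intro u hu s hs
    refine ⟨hu, lt_of_le_of_lt ?_ (hr.trans_le (hmin hu))⟩
    rw [abs_of_nonneg hs.1]
    exact (ENNReal.ofReal_le_ofReal hs.2).trans (by simp)
  have hKΩ : K ⊆ OmegaSet F.ω := fun p hp => hmem p.1 hp.1 p.2 hp.2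
  have hC : ContDiffOn ℝ 1 (fun p : ℝ × ℝ => F.a p.1 p.2) K := F.a_C1.mono hKΩ
  have hUD : UniqueDiffOn ℝ K := (uniqueDiffOn_Icc one_pos).prod (uniqueDiffOn_Icc hr0)
  set D : ℝ × ℝ → ℝ := fun p => fderivWithin ℝ (fun p : ℝ × ℝ => F.a p.1 p.2) K p (0, 1)
    with hD
  have hDc : ContinuousOn D K :=
    (hC.continuousOn_fderivWithin hUD le_rfl).clm_apply continuousOn_const
  have hderiv : ∀ u ∈ Icc (0:ℝ) 1, ∀ s ∈ Icc (0:ℝ) r,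
      HasDerivAt (F.a u) (D (u, s)) s ∧ 0 < D (u, s) := by
    intro u hu s hs
    obtain ⟨d, hd, hda⟩ := F.a_deriv_pos u s (hmem u hu s hs)
    have h1 : HasFDerivWithinAt (fun p : ℝ × ℝ => F.a p.1 p.2)
        (fderivWithin ℝ (fun p : ℝ × ℝ => F.a p.1 p.2) K (u, s)) K (u, s) :=
      (hC.differentiableOn one_ne_zero (u, s) ⟨hu, hs⟩).hasFDerivWithinAt
    have h2 : HasDerivWithinAt (fun t : ℝ => (u, t)) ((0:ℝ), (1:ℝ)) (Icc (0:ℝ) r) s :=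
      (hasDerivWithinAt_const s _ u).prodMk (hasDerivWithinAt_id s _)
    have h3 : HasDerivWithinAt (F.a u) (D (u, s)) (Icc (0:ℝ) r) s :=
      h1.comp_hasDerivWithinAt s h2 fun t ht => ⟨hu, ht⟩
    have h4 : D (u, s) = d :=
      (uniqueDiffOn_Icc hr0 s hs).eq_deriv _ h3 hda.hasDerivWithinAt
    rw [h4]
    exact ⟨hda, hd⟩
  have hKc : IsCompact K := isCompact_Icc.prod isCompact_Icc
  have hKne : K.Nonempty := ⟨(0, 0), by simp [hK, hr0.le]⟩
  obtain ⟨p, hp, hpmin⟩ := hKc.exists_isMinOn hKne hDc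
  obtain ⟨q, hq, hqmax⟩ := hKc.exists_isMaxOn hKne hDc
  refine ⟨r, D p, D q, hr0, (hderiv p.1 hp.1 p.2 hp.2).2, (hderiv q.1 hq.1 q.2 hq.2).2, ?_⟩
  intro u hu s hs
  refine ⟨hmem u hu s hs, ?_⟩
  have hcont : ContinuousOn (F.a u) (Icc (0:ℝ) r) := fun t ht =>
    (hderiv u hu t ht).1.continuousAt.continuousWithinAt
  have hdiff : DifferentiableOn ℝ (F.a u) (interior (Icc (0:ℝ) r)) := fun t ht =>
    (hderiv u hu t (interior_subset ht)).1.differentiableAt.differentiableWithinAt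
  have h0 : (0:ℝ) ∈ Icc (0:ℝ) r := left_mem_Icc.2 hr0.le
  have hlow := (convex_Icc (0:ℝ) r).mul_sub_le_image_sub_of_le_deriv hcont hdiff (C := D p)
    (fun t ht => by
      rw [(hderiv u hu t (interior_subset ht)).1.deriv]
      exact hpmin (show (u, t) ∈ K from ⟨hu, interior_subset ht⟩)) 0 h0 s hs hs.1
  have hup := (convex_Icc (0:ℝ) r).image_sub_le_mul_sub_of_deriv_le hcont hdiff (C := D q)
    (fun t ht => by
      rw [(hderiv u hu t (interior_subset ht)).1.deriv]
      exact hqmax (show (u, t) ∈ K from ⟨hu, interior_subset ht⟩)) 0 h0 s hs hs.1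
  rw [F.a_zero hu, sub_zero, sub_zero] at hlow hup
  exact ⟨hlow, hup⟩

/-- Uniformly in `u`, a lower bound on `a(u,s)` bounds `s` below, and a small value of `a(u,s)`
bounds `s` above linearly. -/
lemma exists_slope_bounds : ∃ s₀ m M : ℝ, 0 < s₀ ∧ 0 < m ∧ 0 < M ∧
    ∀ u s : ℝ, (u, s) ∈ OmegaSet F.ω → 0 < s →
      min s₀ (F.a u s / M) ≤ s ∧ (F.a u s < m * s₀ → s ≤ F.a u s / m) := by
  obtain ⟨s₀, m, M, hs₀, hm, hM, h⟩ := F.exists_linear_bounds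
  refine ⟨s₀, m, M, hs₀, hm, hM, fun u s hus hs => ?_⟩
  rcases le_or_gt s s₀ with hle | hlt
  · obtain ⟨-, h1, h2⟩ := h u hus.1 s ⟨hs.le, hle⟩
    refine ⟨(min_le_right _ _).trans ((div_le_iff₀' hM).2 h2), fun _ => ?_⟩
    exact (le_div_iff₀' hm).2 h1
  · refine ⟨(min_le_left _ _).trans hlt.le, fun hlt' => ?_⟩
    obtain ⟨h0, h1, -⟩ := h u hus.1 s₀ ⟨hs₀.le, le_rfl⟩
    exact absurd hlt' (not_lt.2 (h1.trans (F.a_lt h0 hus hlt).le))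

end FluxData

/-- If `E(1) ≤ 0` and `E` is nondecreasing wherever it is positive, then `E ≤ 0`. -/
lemma nonpos_of_deriv_nonneg_of_pos {E E' : ℝ → ℝ} (hc : ContinuousOn E (Icc 0 1))
    (h1 : E 1 ≤ 0) (hd : ∀ x ∈ Ioo (0:ℝ) 1, HasDerivAt E (E' x) x)
    (hE : ∀ x ∈ Ioo (0:ℝ) 1, 0 < E x → 0 ≤ E' x) {x : ℝ} (hx : x ∈ Icc (0:ℝ) 1) :
    E x ≤ 0 := by
  by_contra! hpos
  set S : Set ℝ := Icc x 1 ∩ E ⁻¹' Iic 0 with hS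
  have hcx : ContinuousOn E (Icc x 1) := hc.mono (Icc_subset_Icc_left hx.1)
  have hScl : IsClosed S := hcx.preimage_isClosed_of_isClosed isClosed_Icc isClosed_Iic
  have hSne : S.Nonempty := ⟨1, right_mem_Icc.2 hx.2, h1⟩
  have hSb : BddBelow S := ⟨x, fun y hy => hy.1.1⟩
  have hcS : sInf S ∈ S := hScl.csInf_mem hSne hSb
  set c := sInf S
  have hmono : MonotoneOn E (Icc x c) := by
    refine monotoneOn_of_hasDerivWithinAt_nonneg (f' := E') (convex_Icc x c)
      (hcx.mono (Icc_subset_Icc_right hcS.1.2)) ?_ ?_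
    all_goals
      intro y hy
      rw [interior_Icc] at hy
      have hy01 : y ∈ Ioo (0:ℝ) 1 := ⟨hx.1.trans_lt hy.1, hy.2.trans_le hcS.1.2⟩
    · exact (hd y hy01).hasDerivWithinAt
    · refine hE y hy01 ?_
      by_contra! hn
      exact (csInf_le hSb ⟨⟨hy.1.le, hy01.2.le⟩, hn⟩).not_gt hy.2
  have := hmono (left_mem_Icc.2 hcS.1.1) (right_mem_Icc.2 hcS.1.1) hcS.1.1
  exact absurd (hpos.trans_le this) (not_lt.2 hcS.2)

namespace IsVsol

variable {F : FluxData} {σ τ : ℝ} {V W : ℝ → ℝ}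

lemma anti (hV : IsVsol F σ V) (hW : IsVsol F τ W) (h : σ ≤ τ) {u : ℝ}
    (hu : u ∈ Icc (0:ℝ) 1) : W u ≤ V u := by
  have := nonpos_of_deriv_nonneg_of_pos (E := fun u => W u - V u)
    (hW.1.sub hV.1) (by simp [hV.2.1, hW.2.1])
    (fun x hx => (hW.2.2.2 x hx).sub (hV.2.2.2 x hx)) (fun x hx hpos => ?_) hu
  · linarith
  · have := F.Hfun_anti (Ioo_subset_Icc_self hx) (hV.2.2.1 x hx) (sub_pos.1 hpos).le
    nlinarith [mul_le_mul_of_nonneg_left this (F.f_pos _ hx).le]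

lemma le_add (hV : IsVsol F σ V) (hW : IsVsol F τ W) (h : σ ≤ τ) {u : ℝ}
    (hu : u ∈ Icc (0:ℝ) 1) : V u ≤ W u + (τ - σ) * (1 - u) := by
  have := nonpos_of_deriv_nonneg_of_pos (E := fun u => V u - W u - (τ - σ) * (1 - u))
    ((hV.1.sub hW.1).sub (by fun_prop)) (by simp [hV.2.1, hW.2.1])
    (fun x hx => ((hV.2.2.2 x hx).sub (hW.2.2.2 x hx)).sub
      (((hasDerivAt_id x).const_sub 1).const_mul (τ - σ))) (fun x hx hpos => ?_) hu
  · linarith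
  · have h0 : 0 ≤ (τ - σ) * (1 - x) := mul_nonneg (sub_nonneg.2 h) (sub_nonneg.2 hx.2.le)
    have := F.Hfun_anti (Ioo_subset_Icc_self hx) (hW.2.2.1 x hx)
      (show W x ≤ V x by linarith)
    nlinarith [mul_le_mul_of_nonneg_left this (F.f_pos _ hx).le]

end IsVsol

namespace IsClassicTW

variable {F : FluxData} {σ : ℝ} {u V : ℝ → ℝ}

lemma differentiable (hu : IsClassicTW F F.a σ u) : Differentiable ℝ u :=
  hu.1.differentiable two_ne_zero

lemma mem_OmegaSet (hu : IsClassicTW F F.a σ u) (ξ : ℝ) : (u ξ, deriv u ξ) ∈ OmegaSet F.ω :=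
  ⟨Ioo_subset_Icc_self (hu.2.1 ξ), by
    simpa [abs_of_pos (hu.2.2.1 ξ).1] using (hu.2.2.1 ξ).2⟩

lemma exists_deriv_lt (hu : IsClassicTW F F.a σ u) {δ : ℝ} (hδ : 0 < δ) (A : ℝ) :
    ∃ ξ ∈ Ioo A (A + 1 / δ), deriv u ξ < δ := by
  have hlt : A < A + 1 / δ := lt_add_of_pos_right _ (one_div_pos.2 hδ)
  obtain ⟨ξ, hξ, h⟩ := exists_deriv_eq_slope u hlt hu.differentiable.continuous.continuousOn
    hu.differentiable.differentiableOn
  refine ⟨ξ, hξ, ?_⟩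
  rw [h, add_sub_cancel_left, div_div_eq_mul_div, div_one]
  nlinarith [(hu.2.1 A).1, (hu.2.1 (A + 1 / δ)).2]

lemma exists_flux_lt (hu : IsClassicTW F F.a σ u) {ε : ℝ} (hε : 0 < ε) :
    ∃ d > 0, ∀ A : ℝ, ∃ ξ ∈ Ioo A (A + d), F.a (u ξ) (deriv u ξ) < ε := by
  obtain ⟨s₀, m, M, hs₀, hm, hM, h⟩ := F.exists_slope_bounds
  have hδ : 0 < min s₀ (ε / M) := lt_min hs₀ (div_pos hε hM)
  refine ⟨1 / min s₀ (ε / M), one_div_pos.2 hδ, fun A => ?_⟩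
  obtain ⟨ξ, hξ, hlt⟩ := hu.exists_deriv_lt hδ A
  refine ⟨ξ, hξ, ?_⟩
  have h1 := (h _ _ (hu.mem_OmegaSet ξ) (hu.2.2.1 ξ).1).1.trans_lt hlt
  rcases min_lt_iff.1 h1 with h2 | h2
  · exact absurd h2 (not_lt.2 (min_le_left _ _))
  · exact (div_lt_div_iff_of_pos_right hM).1 (h2.trans_le (min_le_right _ _))

/-- The flux of a wave, as a function of the profile, is the solution `𝒱_σ`. -/
lemma Vsol_comp_eq (hu : IsClassicTW F F.a σ u) (hV : IsVsol F σ V) (ξ₀ : ℝ) :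
    V (u ξ₀) = F.a (u ξ₀) (deriv u ξ₀) := by
  set Z : ℝ → ℝ := fun ξ => F.a (u ξ) (deriv u ξ) - V (u ξ) with hZ
  have hIcc : ∀ ξ, u ξ ∈ Icc (0:ℝ) 1 := fun ξ => Ioo_subset_Icc_self (hu.2.1 ξ)
  have hapos : ∀ ξ, 0 < F.a (u ξ) (deriv u ξ) := fun ξ =>
    F.a_pos (hu.mem_OmegaSet ξ) (hu.2.2.1 ξ).1
  have hZd : ∀ ξ, HasDerivAt Z (deriv u ξ * F.f (u ξ) *
      (Hfun F (u ξ) (V (u ξ)) - Hfun F (u ξ) (F.a (u ξ) (deriv u ξ)))) ξ := by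
    intro ξ
    have h1 := (hu.2.2.2.2.2 ξ).sub
      ((hV.2.2.2 (u ξ) (hu.2.1 ξ)).comp ξ (hu.differentiable ξ).hasDerivAt)
    refine h1.congr_deriv ?_
    rw [F.Hfun_a (hu.mem_OmegaSet ξ) (hu.2.2.1 ξ).1]
    have := (hu.2.2.1 ξ).1.ne'
    field_simp
    ring
  have hmono : Monotone fun ξ => Z ξ ^ 2 := by
    refine monotone_of_hasDerivAt_nonneg (fun ξ => (hZd ξ).pow 2) fun ξ => ?_
    have hk : 0 ≤ deriv u ξ * F.f (u ξ) :=
      mul_nonneg (hu.2.2.1 ξ).1.le (F.f_pos _ (hu.2.1 ξ)).le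
    have hs : 0 ≤ Z ξ *
        (Hfun F (u ξ) (V (u ξ)) - Hfun F (u ξ) (F.a (u ξ) (deriv u ξ))) := by
      rcases le_total (F.a (u ξ) (deriv u ξ)) (V (u ξ)) with h | h
      · exact mul_nonneg_of_nonpos_of_nonpos (sub_nonpos.2 h)
          (sub_nonpos.2 (F.Hfun_anti (hIcc ξ) (hapos ξ) h))
      · exact mul_nonneg (sub_nonneg.2 h)
          (sub_nonneg.2 (F.Hfun_anti (hIcc ξ) (hV.2.2.1 _ (hu.2.1 ξ)) h))
    have := mul_nonneg hk hs
    simp only [Pi.zero_apply]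
    push_cast
    nlinarith
  by_contra hne
  have hε : 0 < |Z ξ₀| := abs_pos.2 (sub_ne_zero.2 (Ne.symm hne))
  have hVlim : Tendsto (fun ξ => V (u ξ)) atTop (𝓝 0) := by
    have h1 := hV.1 1 (right_mem_Icc.2 zero_le_one)
    rw [ContinuousWithinAt, hV.2.1] at h1
    exact h1.comp (tendsto_nhdsWithin_iff.2 ⟨hu.2.2.2.2.1, Eventually.of_forall hIcc⟩)
  obtain ⟨A, hA⟩ := eventually_atTop.1 (hVlim.eventually (gt_mem_nhds hε))
  obtain ⟨d, -, hd⟩ := hu.exists_flux_lt hε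
  obtain ⟨ξ, hξ, hlt⟩ := hd (max A ξ₀)
  have h1 := hA ξ ((le_max_left _ _).trans hξ.1.le)
  have h2 : Z ξ₀ ^ 2 ≤ Z ξ ^ 2 := hmono ((le_max_right A ξ₀).trans hξ.1.le)
  have h3 : |Z ξ| < |Z ξ₀| := abs_sub_lt_iff.2
    ⟨by linarith [hV.2.2.1 _ (hu.2.1 ξ)], by linarith [hapos ξ]⟩
  exact absurd (sq_le_sq.1 h2) (not_le.2 h3)

lemma Vsol_zero (hu : IsClassicTW F F.a σ u) (hV : IsVsol F σ V) : V 0 = 0 := by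
  have hIcc : ∀ ξ, u ξ ∈ Icc (0:ℝ) 1 := fun ξ => Ioo_subset_Icc_self (hu.2.1 ξ)
  have hlim : Tendsto (fun ξ => V (u ξ)) atBot (𝓝 (V 0)) :=
    (hV.1 0 (left_mem_Icc.2 zero_le_one)).tendsto.comp
      (tendsto_nhdsWithin_iff.2 ⟨hu.2.2.2.1, Eventually.of_forall hIcc⟩)
  have h0 : 0 ≤ V 0 := ge_of_tendsto' hlim fun ξ => (hV.2.2.1 _ (hu.2.1 ξ)).le
  by_contra hne
  have hpos : 0 < V 0 := lt_of_le_of_ne h0 (Ne.symm hne)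
  obtain ⟨A, hA⟩ := eventually_atBot.1 (hlim.eventually (lt_mem_nhds (half_lt_self hpos)))
  obtain ⟨d, -, hd⟩ := hu.exists_flux_lt (half_pos hpos)
  obtain ⟨ξ, hξ, hlt⟩ := hd (A - d)
  rw [sub_add_cancel] at hξ
  have := hA ξ hξ.2.le
  rw [hu.Vsol_comp_eq hV] at this
  exact lt_asymm this hlt

lemma surj (hu : IsClassicTW F F.a σ u) {t : ℝ} (ht : t ∈ Ioo (0:ℝ) 1) : ∃ ξ, u ξ = t :=
  mem_range_of_exists_le_of_exists_ge hu.differentiable.continuous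
    (hu.2.2.2.1.eventually (ge_mem_nhds ht.1)).exists
    (hu.2.2.2.2.1.eventually (le_mem_nhds ht.2)).exists

lemma Vsol_lt_aplus (hu : IsClassicTW F F.a σ u) (hV : IsVsol F σ V) {t : ℝ}
    (ht : t ∈ Icc (0:ℝ) 1) : ENNReal.ofReal (V t) < F.aplus t := by
  rcases ht.1.eq_or_lt with rfl | h0
  · simpa [hu.Vsol_zero hV] using F.aplus_pos 0 ht
  rcases ht.2.eq_or_lt with rfl | h1
  · simpa [hV.2.1] using F.aplus_pos 1 ht
  obtain ⟨ξ, rfl⟩ := hu.surj ⟨h0, h1⟩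
  rw [hu.Vsol_comp_eq hV]
  exact F.ofReal_a_lt (hu.mem_OmegaSet ξ) (hu.2.2.1 ξ).1

end IsClassicTW

namespace FluxData

variable (F : FluxData)

lemma OmegaSet_mem_nhds {u s : ℝ} (hu : u ∈ Ioo (0:ℝ) 1) (hs : (u, s) ∈ OmegaSet F.ω) :
    OmegaSet F.ω ∈ 𝓝 (u, s) := by
  obtain ⟨r, hr1, hr2⟩ := ENNReal.lt_iff_exists_nnreal_btwn.1 hs.2
  have h1 : ∀ᶠ x in 𝓝 u, x ∈ Icc (0:ℝ) 1 ∧ (r:ℝ≥0∞) < F.ω x := by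
    have hI : Icc (0:ℝ) 1 ∈ 𝓝 u := Icc_mem_nhds hu.1 hu.2
    have := F.ω_lsc u hs.1 r hr2
    rw [nhdsWithin_eq_nhds.2 hI] at this
    exact (eventually_mem_set.2 hI).and this
  have h2 : ∀ᶠ y in 𝓝 s, ENNReal.ofReal |y| < r :=
    (ENNReal.continuous_ofReal.comp continuous_abs).continuousAt.eventually (gt_mem_nhds hr1)
  filter_upwards [h1.prod_nhds h2] with p hp
  exact ⟨hp.1.1, hp.2.trans hp.1.2⟩

lemma contDiffAt_g {u s : ℝ} (hu : u ∈ Ioo (0:ℝ) 1) (hus : (u, s) ∈ OmegaSet F.ω)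
    (hs : 0 < s) : ContDiffAt ℝ 1 (fun p : ℝ × ℝ => F.g p.1 p.2) (u, F.a u s) := by
  have hΩ := F.OmegaSet_mem_nhds hu hus
  have ha : ContDiffAt ℝ 1 (fun p : ℝ × ℝ => F.a p.1 p.2) (u, s) := F.a_C1.contDiffAt hΩ
  set Φ : ℝ × ℝ → ℝ × ℝ := fun p => (p.1, F.a p.1 p.2) with hΦ
  have hΦc : ContDiffAt ℝ 1 Φ (u, s) := contDiffAt_fst.prodMk ha
  set L : ℝ × ℝ →L[ℝ] ℝ := fderiv ℝ (fun p : ℝ × ℝ => F.a p.1 p.2) (u, s) with hL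
  have haL : HasFDerivAt (fun p : ℝ × ℝ => F.a p.1 p.2) L (u, s) :=
    (ha.differentiableAt one_ne_zero).hasFDerivAt
  have hΦL : HasFDerivAt Φ ((ContinuousLinearMap.fst ℝ ℝ ℝ).prod L) (u, s) :=
    hasFDerivAt_fst.prodMk haL
  have hL1 : L (0, 1) ≠ 0 := by
    obtain ⟨d, hd, hda⟩ := F.a_deriv_pos u s hus
    have h1 : HasDerivAt (fun t : ℝ => (u, t)) ((0:ℝ), (1:ℝ)) s :=
      (hasDerivAt_const s u).prodMk (hasDerivAt_id s)
    have h2 : HasDerivAt (F.a u) (L (0, 1)) s :=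
      HasFDerivAt.comp_hasDerivAt (f := fun t : ℝ => (u, t)) s haL h1
    rw [h2.unique hda]
    exact hd.ne'
  have hinj : Function.Injective
      ((ContinuousLinearMap.fst ℝ ℝ ℝ).prod L : ℝ × ℝ →ₗ[ℝ] ℝ × ℝ) := by
    rw [← LinearMap.ker_eq_bot, LinearMap.ker_eq_bot']
    rintro ⟨x, y⟩ h
    simp only [ContinuousLinearMap.coe_coe, ContinuousLinearMap.prod_apply,
      ContinuousLinearMap.coe_fst', Prod.mk_eq_zero] at h
    obtain ⟨rfl, h2⟩ := h
    have : ((0:ℝ), y) = y • ((0:ℝ), (1:ℝ)) := by simp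
    rw [this, map_smul, smul_eq_mul] at h2
    rcases mul_eq_zero.1 h2 with rfl | h3
    · rfl
    · exact absurd h3 hL1
  set A : (ℝ × ℝ) ≃L[ℝ] (ℝ × ℝ) :=
    (LinearEquiv.ofInjectiveEndo _ hinj).toContinuousLinearEquiv with hA
  have hΦA : HasFDerivAt Φ (A : ℝ × ℝ →L[ℝ] ℝ × ℝ) (u, s) := by
    convert hΦL using 1
    exact ContinuousLinearMap.ext fun _ => rfl
  have hinv := hΦc.to_localInverse hΦA one_ne_zero
  set e := hΦc.toOpenPartialHomeomorph Φ hΦA one_ne_zero with he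
  have hinv' : ContDiffAt ℝ 1 e.symm (Φ (u, s)) := hinv
  have hsrc : (u, s) ∈ e.source := hΦc.mem_toOpenPartialHomeomorph_source hΦA one_ne_zero
  have htgt : Φ (u, s) ∈ e.target := e.map_source hsrc
  have hsymm : e.symm (Φ (u, s)) = (u, s) := e.left_inv hsrc
  refine (contDiffAt_snd.comp (Φ (u, s)) hinv').congr_of_eventuallyEq ?_
  have hT : Tendsto e.symm (𝓝 (Φ (u, s))) (𝓝 (u, s)) := by
    simpa [ContinuousAt, hsymm] using hinv'.continuousAt
  have hpos : ∀ᶠ p : ℝ × ℝ in 𝓝 (u, s), 0 < p.2 :=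
    continuous_snd.continuousAt.eventually (lt_mem_nhds hs)
  filter_upwards [hT.eventually hΩ, hT.eventually hpos, e.open_target.mem_nhds htgt]
    with q hq1 hq2 hq3
  have hq : Φ (e.symm q) = q := e.right_inv hq3
  have h1 : (e.symm q).1 = q.1 := show (Φ (e.symm q)).1 = q.1 by rw [hq]
  have h2 : F.a (e.symm q).1 (e.symm q).2 = q.2 :=
    show (Φ (e.symm q)).2 = q.2 by rw [hq]
  change F.g q.1 q.2 = (e.symm q).2
  rw [← h2, ← h1]
  exact F.g_a hq1 hq2

end FluxData

/-- If `T' = 1/h` on `(0,1)` and `h` is at most linear at `0`, then `T` is unbounded below. -/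
lemma exists_le_of_hasDerivAt_inv {h T : ℝ → ℝ} {C δ : ℝ} (hC : 0 < C) (hδ : 0 < δ)
    (hδ1 : δ < 1) (hpos : ∀ t ∈ Ioo (0:ℝ) 1, 0 < h t)
    (hT : ∀ t ∈ Ioo (0:ℝ) 1, HasDerivAt T (1 / h t) t)
    (hle : ∀ t ∈ Ioo 0 δ, h t ≤ C * t) (y : ℝ) : ∃ t ∈ Ioo (0:ℝ) 1, T t ≤ y := by
  have hmem : ∀ t ∈ Ioc 0 δ, t ∈ Ioo (0:ℝ) 1 := fun t ht => ⟨ht.1, ht.2.trans_lt hδ1⟩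
  have hd : ∀ t ∈ Ioc 0 δ, HasDerivAt (fun t => T t - C⁻¹ * Real.log t)
      (1 / h t - C⁻¹ * t⁻¹) t := fun t ht =>
    (hT t (hmem t ht)).sub ((Real.hasDerivAt_log ht.1.ne').const_mul _)
  have hmono : MonotoneOn (fun t => T t - C⁻¹ * Real.log t) (Ioc 0 δ) := by
    refine monotoneOn_of_hasDerivWithinAt_nonneg (f' := fun t => 1 / h t - C⁻¹ * t⁻¹)
      (convex_Ioc 0 δ) (fun t ht => (hd t ht).continuousAt.continuousWithinAt)
      (fun t ht => (hd t (interior_subset ht)).hasDerivWithinAt) fun t ht => ?_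
    rw [interior_Ioc] at ht
    have := one_div_le_one_div_of_le (hpos t ⟨ht.1, ht.2.trans hδ1⟩) (hle t ht)
    rw [← mul_inv, inv_eq_one_div]
    linarith
  set k := |C * (y - T δ)| with hk
  have hk0 : 0 ≤ k := abs_nonneg _
  have htd : δ * Real.exp (-k) ≤ δ :=
    mul_le_of_le_one_right hδ.le (Real.exp_le_one_iff.2 (neg_nonpos.2 hk0))
  have ht : δ * Real.exp (-k) ∈ Ioc 0 δ := ⟨mul_pos hδ (Real.exp_pos _), htd⟩
  refine ⟨_, hmem _ ht, ?_⟩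
  have h1 := hmono ht (right_mem_Ioc.2 hδ) htd
  simp only [Real.log_mul hδ.ne' (Real.exp_pos _).ne', Real.log_exp] at h1
  have h2 : -(C * (y - T δ)) ≤ k := neg_le_abs _
  have h3 : C⁻¹ * (-k) ≤ y - T δ := by
    rw [inv_mul_le_iff₀ hC]
    linarith
  linarith

/-- The autonomous equation `u' = h(u)` on `(0,1)` with `h` at most linear at both ends has a
heteroclinic solution from `0` to `1`. -/
lemma exists_heteroclinic {h : ℝ → ℝ} {C δ : ℝ} (hC : 0 < C) (hδ : 0 < δ) (hδ1 : δ < 1)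
    (hh : ContDiffOn ℝ 1 h (Ioo 0 1)) (hpos : ∀ t ∈ Ioo (0:ℝ) 1, 0 < h t)
    (h0 : ∀ t ∈ Ioo 0 δ, h t ≤ C * t) (h1 : ∀ t ∈ Ioo (1 - δ) 1, h t ≤ C * (1 - t)) :
    ∃ u : ℝ → ℝ, ContDiff ℝ 2 u ∧ (∀ ξ, u ξ ∈ Ioo (0:ℝ) 1) ∧
      (∀ ξ, HasDerivAt u (h (u ξ)) ξ) ∧ Tendsto u atBot (𝓝 0) ∧ Tendsto u atTop (𝓝 1) := by
  have hcinv : ContinuousOn (fun t => 1 / h t) (Ioo 0 1) :=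
    continuousOn_const.div hh.continuousOn fun t ht => (hpos t ht).ne'
  set T : ℝ → ℝ := fun t => ∫ x in (1/2 : ℝ)..t, 1 / h x with hTdef
  have hT : ∀ t ∈ Ioo (0:ℝ) 1, HasDerivAt T (1 / h t) t := by
    intro t ht
    have hsub : uIcc (1/2 : ℝ) t ⊆ Ioo 0 1 := by
      have : OrdConnected (Ioo (0:ℝ) 1) := ordConnected_Ioo
      exact this.uIcc_subset ⟨by norm_num, by norm_num⟩ ht
    exact intervalIntegral.integral_hasDerivAt_right (hcinv.mono hsub).intervalIntegrable
      (hcinv.stronglyMeasurableAtFilter isOpen_Ioo t ht) (hcinv.continuousAt (isOpen_Ioo.mem_nhds ht))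
  have hTc : ContinuousOn T (Ioo 0 1) := fun t ht => (hT t ht).continuousAt.continuousWithinAt
  have hTm : StrictMonoOn T (Ioo 0 1) := by
    refine strictMonoOn_of_deriv_pos (convex_Ioo 0 1) hTc fun t ht => ?_
    rw [interior_Ioo] at ht
    rw [(hT t ht).deriv]
    exact one_div_pos.2 (hpos t ht)
  have hsurj : ∀ y, ∃ t ∈ Ioo (0:ℝ) 1, T t = y := by
    intro y
    obtain ⟨t₁, ht₁, hy₁⟩ := exists_le_of_hasDerivAt_inv hC hδ hδ1 hpos hT h0 y
    obtain ⟨t₂, ht₂, hy₂⟩ := exists_le_of_hasDerivAt_inv (h := fun t => h (1 - t))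
      (T := fun t => - T (1 - t)) hC hδ hδ1
      (fun t ht => hpos _ ⟨by linarith [ht.2], by linarith [ht.1]⟩)
      (fun t ht => by
        have := (hT (1 - t) ⟨by linarith [ht.2], by linarith [ht.1]⟩).comp t
          ((hasDerivAt_id t).const_sub 1)
        exact this.neg.congr_deriv (by ring))
      (fun t ht => by
        simpa using h1 (1 - t) ⟨by linarith [ht.2], by linarith [ht.1]⟩) (-y)
    have ht₂' : 1 - t₂ ∈ Ioo (0:ℝ) 1 := ⟨by linarith [ht₂.2], by linarith [ht₂.1]⟩
    exact isPreconnected_Ioo.intermediate_value ht₁ ht₂' hTc ⟨hy₁, neg_le_neg_iff.1 hy₂⟩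
  set e : Ioo (0:ℝ) 1 ≃o ℝ := StrictMono.orderIsoOfSurjective (fun t : Ioo (0:ℝ) 1 => T t)
    (fun s t hst => hTm s.2 t.2 hst)
    (fun y => by obtain ⟨t, ht, hy⟩ := hsurj y; exact ⟨⟨t, ht⟩, hy⟩) with he
  have heT : ∀ t, e t = T t := fun t => rfl
  set u : ℝ → ℝ := fun ξ => (e.symm ξ : ℝ) with hu
  have huc : Continuous u := continuous_subtype_val.comp e.symm.continuous
  have humem : ∀ ξ, u ξ ∈ Ioo (0:ℝ) 1 := fun ξ => (e.symm ξ).2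
  have hTu : ∀ ξ, T (u ξ) = ξ := fun ξ => by rw [← heT, e.apply_symm_apply]
  have hud : ∀ ξ, HasDerivAt u (h (u ξ)) ξ := by
    intro ξ
    have := HasDerivAt.of_local_left_inverse huc.continuousAt (hT (u ξ) (humem ξ))
      (one_div_pos.2 (hpos _ (humem ξ))).ne' (Eventually.of_forall hTu)
    simpa using this
  have hderiv : deriv u = fun ξ => h (u ξ) := funext fun ξ => (hud ξ).deriv
  have hu1 : ContDiff ℝ 1 u := by
    rw [contDiff_one_iff_deriv, hderiv]
    exact ⟨fun ξ => (hud ξ).differentiableAt,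
      hh.continuousOn.comp_continuous huc humem⟩
  refine ⟨u, ?_, humem, hud, ?_, ?_⟩
  · rw [show (2 : WithTop ℕ∞) = 1 + 1 by norm_num, contDiff_succ_iff_deriv, hderiv]
    refine ⟨fun ξ => (hud ξ).differentiableAt, by simp, ?_⟩
    exact hh.comp_contDiff hu1 humem
  · refine tendsto_order.2 ⟨fun b hb => Eventually.of_forall fun ξ => hb.trans (humem ξ).1,
      fun b hb => ?_⟩
    rcases le_or_gt 1 b with hb1 | hb1
    · exact Eventually.of_forall fun ξ => (humem ξ).2.trans_le hb1
    · filter_upwards [eventually_lt_atBot (T b)] with ξ hξ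
      rw [← hTu ξ] at hξ
      exact (hTm.lt_iff_lt (humem ξ) ⟨hb, hb1⟩).1 hξ
  · refine tendsto_order.2 ⟨fun b hb => ?_,
      fun b hb => Eventually.of_forall fun ξ => (humem ξ).2.trans hb⟩
    rcases le_or_gt b 0 with hb1 | hb1
    · exact Eventually.of_forall fun ξ => hb1.trans_lt (humem ξ).1
    · filter_upwards [eventually_gt_atTop (T b)] with ξ hξ
      rw [← hTu ξ] at hξ
      exact (hTm.lt_iff_lt ⟨hb1, hb⟩ (humem ξ)).1 hξ

namespace IsVsol

variable {F : FluxData} {σ : ℝ} {V : ℝ → ℝ}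

lemma le_mul_self (hV : IsVsol F σ V) (h0 : V 0 = 0) {t : ℝ} (ht : t ∈ Icc (0:ℝ) 1) :
    V t ≤ σ * t := by
  have := (convex_Icc (0:ℝ) 1).image_sub_le_mul_sub_of_deriv_le hV.1
    (fun x hx => (hV.2.2.2 x (by rwa [interior_Icc] at hx)).differentiableAt.differentiableWithinAt)
    (C := σ) (fun x hx => by
      rw [interior_Icc] at hx
      rw [(hV.2.2.2 x hx).deriv]
      have := mul_nonneg (F.f_pos _ hx).le
        (F.Hfun_nonneg (Ioo_subset_Icc_self hx) (hV.2.2.1 x hx))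
      linarith) 0 (left_mem_Icc.2 zero_le_one) t ht ht.1
  simpa [h0] using this

lemma exists_le_mul_one_sub (hV : IsVsol F σ V) (hσ : 0 ≤ σ) :
    ∃ K : ℝ, 0 < K ∧ ∀ t ∈ Icc (0:ℝ) 1, V t ≤ K * (1 - t) := by
  obtain ⟨s₀, m, M, hs₀, hm, hM, hb⟩ := F.exists_slope_bounds
  obtain ⟨L, hL⟩ := F.f_C1.exists_lipschitzOnWith one_ne_zero (convex_Icc 0 1) isCompact_Icc
  have hf : ∀ t ∈ Icc (0:ℝ) 1, F.f t ≤ L * (1 - t) := by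
    intro t ht
    have := hL.dist_le_mul t ht 1 (right_mem_Icc.2 zero_le_one)
    rw [F.f_one, Real.dist_eq, Real.dist_eq, sub_zero, abs_sub_comm,
      abs_of_nonneg (sub_nonneg.2 ht.2)] at this
    exact (le_abs_self _).trans this
  have hL0 : (0:ℝ) ≤ L := L.2
  have hLs : 0 ≤ L / s₀ := div_nonneg hL0 hs₀.le
  have hLM : 0 ≤ L * M := mul_nonneg hL0 hM.le
  set K : ℝ := 1 + L / s₀ + L * M with hK
  have hK1 : 1 ≤ K := by linarith
  refine ⟨K, by linarith, fun t ht => ?_⟩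
  have := nonpos_of_deriv_nonneg_of_pos (E := fun t => V t - K * (1 - t))
    (hV.1.sub (by fun_prop)) (by simp [hV.2.1])
    (fun x hx => (hV.2.2.2 x hx).sub (((hasDerivAt_id x).const_sub 1).const_mul K))
    (fun x hx hpos => ?_) ht
  · linarith
  have hx' := Ioo_subset_Icc_self hx
  have hVx := hV.2.2.1 x hx
  have h1x : 0 < 1 - x := sub_pos.2 hx.2
  suffices F.f x * Hfun F x (V x) ≤ K by linarith
  by_cases hlt : ENNReal.ofReal (V x) < F.aplus x
  · have hg := F.g_spec _ (F.mem_DSet hx' hVx.le hlt)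
    have hgpos := F.g_pos hx' hVx hlt
    have hmin := (hb _ _ hg.1 hgpos).1
    rw [hg.2] at hmin
    rw [Hfun, if_pos hlt, mul_one_div, div_le_iff₀ hgpos]
    refine (hf x hx').trans ?_
    rcases min_le_iff.1 hmin with h | h
    · calc (L:ℝ) * (1 - x) ≤ L * 1 := by gcongr; linarith [hx.1]
        _ = L / s₀ * s₀ := by field_simp
        _ ≤ K * F.g x (V x) := by
          have : L / s₀ ≤ K := by linarith
          gcongr
    · rw [div_le_iff₀ hM] at h
      have h2 : 1 - x ≤ F.g x (V x) * M := by nlinarith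
      calc (L:ℝ) * (1 - x) ≤ L * (F.g x (V x) * M) := by gcongr
        _ = L * M * F.g x (V x) := by ring
        _ ≤ K * F.g x (V x) := by
          have : L * M ≤ K := by linarith
          gcongr
  · rw [Hfun, if_neg hlt, mul_zero]
    linarith

lemma contDiffAt_g (hV : IsVsol F σ V)
    (hlt : ∀ t ∈ Ioo (0:ℝ) 1, ENNReal.ofReal (V t) < F.aplus t)
    {t : ℝ} (ht : t ∈ Ioo (0:ℝ) 1) :
    ContDiffAt ℝ 1 (fun p : ℝ × ℝ => F.g p.1 p.2) (t, V t) := by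
  have ht' := Ioo_subset_Icc_self ht
  have hg := F.g_spec _ (F.mem_DSet ht' (hV.2.2.1 t ht).le (hlt t ht))
  have := F.contDiffAt_g ht hg.1 (F.g_pos ht' (hV.2.2.1 t ht) (hlt t ht))
  rwa [hg.2] at this

lemma contDiffOn_g_comp (hV : IsVsol F σ V)
    (hlt : ∀ t ∈ Ioo (0:ℝ) 1, ENNReal.ofReal (V t) < F.aplus t) :
    ContDiffOn ℝ 1 (fun t => F.g t (V t)) (Ioo 0 1) := by
  have hpos : ∀ t ∈ Ioo (0:ℝ) 1, 0 < F.g t (V t) := fun t ht =>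
    F.g_pos (Ioo_subset_Icc_self ht) (hV.2.2.1 t ht) (hlt t ht)
  have hVd : ∀ t ∈ Ioo (0:ℝ) 1, HasDerivAt V (σ - F.f t / F.g t (V t)) t := fun t ht => by
    have := hV.2.2.2 t ht
    rwa [Hfun, if_pos (hlt t ht), mul_one_div] at this
  have hgc : ContinuousOn (fun t => F.g t (V t)) (Ioo 0 1) := fun t ht =>
    (ContinuousAt.comp (f := fun t => (t, V t)) (hV.contDiffAt_g hlt ht).continuousAt
      (continuousAt_id.prodMk (hVd t ht).continuousAt)).continuousWithinAt
  have hVC : ContDiffOn ℝ 1 V (Ioo 0 1) := by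
    rw [show (1 : WithTop ℕ∞) = 0 + 1 by norm_num, contDiffOn_succ_iff_deriv_of_isOpen isOpen_Ioo]
    refine ⟨fun t ht => (hVd t ht).differentiableAt.differentiableWithinAt, by simp, ?_⟩
    rw [contDiffOn_zero]
    refine ContinuousOn.congr (f := fun t => σ - F.f t / F.g t (V t)) ?_
      fun t ht => (hVd t ht).deriv
    exact continuousOn_const.sub ((F.f_C1.continuousOn.mono Ioo_subset_Icc_self).div hgc
      fun t ht => (hpos t ht).ne')
  intro t ht
  exact ((hV.contDiffAt_g hlt ht).comp (f := fun t => (t, V t)) t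
    (contDiffAt_id.prodMk (hVC.contDiffAt (isOpen_Ioo.mem_nhds ht)))).contDiffWithinAt

/-- If `𝒱_σ` vanishes at `0` and stays below `a₊`, there is a classic wave of speed `σ`. -/
lemma exists_isClassicTW (hV : IsVsol F σ V)
    (hlt : ∀ t ∈ Ioo (0:ℝ) 1, ENNReal.ofReal (V t) < F.aplus t)
    (hσ : 0 ≤ σ) (h0 : V 0 = 0) : ∃ u, IsClassicTW F F.a σ u := by
  have hpos : ∀ t ∈ Ioo (0:ℝ) 1, 0 < F.g t (V t) := fun t ht =>
    F.g_pos (Ioo_subset_Icc_self ht) (hV.2.2.1 t ht) (hlt t ht)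
  have hspec : ∀ t ∈ Ioo (0:ℝ) 1, (t, F.g t (V t)) ∈ OmegaSet F.ω ∧
      F.a t (F.g t (V t)) = V t := fun t ht =>
    F.g_spec _ (F.mem_DSet (Ioo_subset_Icc_self ht) (hV.2.2.1 t ht).le (hlt t ht))
  obtain ⟨s₀, m, M, hs₀, hm, hM, hb⟩ := F.exists_slope_bounds
  obtain ⟨K, hK, hVK⟩ := hV.exists_le_mul_one_sub hσ
  set C : ℝ := σ + K with hC
  have hC0 : 0 < C := by linarith
  set δ : ℝ := min (1/2) (m * s₀ / C) with hδ
  have hδ0 : 0 < δ := lt_min one_half_pos (div_pos (mul_pos hm hs₀) hC0)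
  have hδ1 : δ < 1 := (min_le_left _ _).trans_lt one_half_lt_one
  have key : ∀ t ∈ Ioo (0:ℝ) 1, ∀ r < δ, V t ≤ C * r → F.g t (V t) ≤ C / m * r := by
    intro t ht r hr hVr
    obtain ⟨h1, h2⟩ := hspec t ht
    have h3 := (hb _ _ h1 (hpos t ht)).2
    rw [h2] at h3
    have h4 : C * r < m * s₀ :=
      (lt_div_iff₀' hC0).1 (hr.trans_le (min_le_right _ _))
    refine (h3 (hVr.trans_lt h4)).trans ?_
    rw [div_mul_eq_mul_div]
    gcongr
  obtain ⟨u, hu2, hu01, hud, hbot, htop⟩ := exists_heteroclinic (div_pos hC0 hm) hδ0 hδ1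
    (hV.contDiffOn_g_comp hlt) hpos
    (fun t ht => by
      have ht' : t ∈ Ioo (0:ℝ) 1 := ⟨ht.1, ht.2.trans hδ1⟩
      refine key t ht' t ht.2 ((hV.le_mul_self h0 (Ioo_subset_Icc_self ht')).trans ?_)
      nlinarith [ht.1])
    (fun t ht => by
      have ht' : t ∈ Ioo (0:ℝ) 1 := ⟨by linarith [ht.1], ht.2⟩
      refine key t ht' (1 - t) (by linarith [ht.1]) ((hVK t (Ioo_subset_Icc_self ht')).trans ?_)
      nlinarith [ht.2])
  have hderiv : ∀ ξ, deriv u ξ = F.g (u ξ) (V (u ξ)) := fun ξ => (hud ξ).deriv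
  refine ⟨u, hu2, hu01, fun ξ => ?_, hbot, htop, fun ξ => ?_⟩
  · rw [hderiv]
    have h1 := hpos _ (hu01 ξ)
    exact ⟨h1, by simpa [abs_of_pos h1] using (hspec _ (hu01 ξ)).1.2⟩
  · have heq : (fun t => F.a (u t) (deriv u t)) = fun t => V (u t) := funext fun t => by
      rw [hderiv, (hspec _ (hu01 t)).2]
    rw [heq, hderiv]
    have hne := (hpos _ (hu01 ξ)).ne'
    refine ((hV.2.2.2 _ (hu01 ξ)).comp ξ (hud ξ)).congr_deriv ?_
    rw [Hfun, if_pos (hlt _ (hu01 ξ))]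
    field_simp

end IsVsol

/-- A continuous function staying strictly below a continuous extended bound on a compact set
stays uniformly below it. -/
lemma IsCompact.exists_pos_ofReal_add_lt {s : Set ℝ} (hs : IsCompact s) {V : ℝ → ℝ}
    {b : ℝ → ℝ≥0∞} (hV : ContinuousOn V s) (hb : ContinuousOn b s)
    (h : ∀ t ∈ s, ENNReal.ofReal (V t) < b t) :
    ∃ η : ℝ, 0 < η ∧ ∀ t ∈ s, ENNReal.ofReal (V t + η) < b t := by
  have hloc : ∀ t ∈ s, ∃ η : ℝ, 0 < η ∧ ∀ᶠ x in 𝓝[s] t, ENNReal.ofReal (V x + η) < b x := by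
    intro t ht
    have hcont : Tendsto (fun p : ℝ × ℝ => ENNReal.ofReal (V p.1 + p.2)) (𝓝[s] t ×ˢ 𝓝 0)
        (𝓝 (ENNReal.ofReal (V t))) := by
      refine (ENNReal.continuous_ofReal.tendsto _).comp ?_
      have := ((hV t ht).tendsto.comp tendsto_fst).add
        (tendsto_snd (f := 𝓝[s] t) (g := 𝓝 (0:ℝ)))
      simpa using this
    have hbt : Tendsto (fun p : ℝ × ℝ => b p.1) (𝓝[s] t ×ˢ 𝓝 (0:ℝ)) (𝓝 (b t)) :=
      (hb t ht).tendsto.comp tendsto_fst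
    obtain ⟨pa, hpa, pb, hpb, hp⟩ :=
      eventually_prod_iff.1 (hcont.eventually_lt hbt (h t ht))
    obtain ⟨η, hη, hη0⟩ :=
      ((hpb.filter_mono nhdsWithin_le_nhds).and (self_mem_nhdsWithin (s := Ioi (0:ℝ)))).exists
    exact ⟨η, hη0, hpa.mono fun x hx => hp hx hη⟩
  refine hs.induction_on (p := fun s => ∃ η : ℝ, 0 < η ∧ ∀ t ∈ s, ENNReal.ofReal (V t + η) < b t)
    ⟨1, one_pos, by simp⟩ ?_ ?_ ?_
  · rintro s t hst ⟨η, hη, ht⟩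
    exact ⟨η, hη, fun x hx => ht x (hst hx)⟩
  · rintro s t ⟨η, hη, hsη⟩ ⟨θ, hθ, htθ⟩
    refine ⟨min η θ, lt_min hη hθ, ?_⟩
    rintro x (hx | hx)
    · exact (ENNReal.ofReal_le_ofReal (by gcongr; exact min_le_left _ _)).trans_lt (hsη x hx)
    · exact (ENNReal.ofReal_le_ofReal (by gcongr; exact min_le_right _ _)).trans_lt (htθ x hx)
  · intro t ht
    obtain ⟨η, hη, hev⟩ := hloc t ht
    exact ⟨_, hev, η, hη, fun x hx => hx⟩

theorem stmt7 (F : FluxData) (hc : ContinuousOn F.aplus (Set.Icc (0:ℝ) 1))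
    (𝒱 : ℝ → ℝ → ℝ) (h𝒱 : ∀ σ : ℝ, 0 ≤ σ → IsVsol F σ (𝒱 σ))
    (σs σr : ℝ)
    (hσs : σs = sInf {σ : ℝ | 0 ≤ σ ∧ 𝒱 σ 0 = 0})
    (hne : {σ : ℝ | 0 ≤ σ ∧ 𝒱 σ 0 = 0}.Nonempty)
    (hσr : σr = sInf {σ : ℝ | 0 < σ ∧ ∃ u : ℝ → ℝ, IsClassicTW F F.a σ u})
    (hTW : ∃ u : ℝ → ℝ, IsClassicTW F F.a σr u) :
    σs = σr := by
  obtain ⟨u, hu⟩ := hTW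
  have hσr0 : 0 ≤ σr := hσr ▸ Real.sInf_nonneg fun σ hσ => hσ.1.le
  have hVr := h𝒱 σr hσr0
  have hbdd : BddBelow {σ : ℝ | 0 ≤ σ ∧ 𝒱 σ 0 = 0} := ⟨0, fun σ hσ => hσ.1⟩
  refine le_antisymm (hσs ▸ csInf_le hbdd ⟨hσr0, hu.Vsol_zero hVr⟩) ?_
  by_contra! hlt
  rw [hσs] at hlt
  obtain ⟨σ₁, ⟨hσ₁, hσ₁0⟩, hσ₁r⟩ := exists_lt_of_csInf_lt hne hlt
  obtain ⟨η, hη, hbelow⟩ := isCompact_Icc.exists_pos_ofReal_add_lt hVr.1 hc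
    fun t ht => hu.Vsol_lt_aplus hVr ht
  obtain ⟨τ, hτ, hτr⟩ := exists_between (max_lt hσ₁r (sub_lt_self σr hη))
  rw [max_lt_iff] at hτ
  have hτ0 : 0 < τ := hσ₁.trans_lt hτ.1
  have hVτ := h𝒱 τ hτ0.le
  have h0 : (0:ℝ) ∈ Icc (0:ℝ) 1 := left_mem_Icc.2 zero_le_one
  have hVτ0 : 𝒱 τ 0 = 0 := le_antisymm
    (((h𝒱 σ₁ hσ₁).anti hVτ hτ.1.le h0).trans_eq hσ₁0)
    ((hu.Vsol_zero hVr).symm.trans_le (hVτ.anti hVr hτr.le h0))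
  have hτTW : ∃ u, IsClassicTW F F.a τ u := by
    refine hVτ.exists_isClassicTW (fun t ht => ?_) hτ0.le hVτ0
    refine (ENNReal.ofReal_le_ofReal ?_).trans_lt (hbelow t (Ioo_subset_Icc_self ht))
    have := hVτ.le_add hVr hτr.le (Ioo_subset_Icc_self ht)
    nlinarith [ht.1, ht.2, hτ.2]
  have : σr ≤ τ := hσr ▸ csInf_le ⟨0, fun σ hσ => hσ.1.le⟩ ⟨hτ0, hτTW⟩
  exact this.not_gt hτr
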